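/- arXiv:1703.03878 — 3 statements merged into one kernel-verified Lean document; each statement's English description precedes it below -/
import Mathlib

section
/- Let n ≥ 5 be an integer. There exists a constant C > 0 such that for every R ≥ 1, |∫_{B(0,R)} (1−‖z‖²)/(1+‖z‖²)^{n+1} dz| ≤ C·R^{−n}, where B(0,R) is the Euclidean ball of radius R centered at the origin in ℝⁿ. -/
open MeasureTheory

lemma hasDerivAt_pow_div_one_add_sq_pow (n : ℕ) (hn : n ≠ 0) (r : ℝ) :
    HasDerivAt (fun r : ℝ => r ^ n / (n * (1 + r ^ 2) ^ n))
      (r ^ (n - 1) * ((1 - r ^ 2) / (1 + r ^ 2) ^ (n + 1))) r := by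
  have hpos : 0 < 1 + r ^ 2 := by positivity
  have hn' : (n : ℝ) ≠ 0 := by exact_mod_cast hn
  have h := (hasDerivAt_pow n r).div
    ((((hasDerivAt_pow 2 r).const_add 1).pow n).const_mul (n : ℝ))
    (mul_ne_zero hn' (pow_pos hpos n).ne')
  refine h.congr_deriv ?_
  obtain ⟨m, rfl⟩ := Nat.exists_eq_succ_of_ne_zero hn
  simp only [Nat.succ_eq_add_one, Nat.add_sub_cancel, Pi.pow_apply] at *
  field_simp
  push_cast
  ring

lemma setIntegral_ball_one_sub_norm_sq (n : ℕ) (hn : n ≠ 0) (R : ℝ) (hR : 0 ≤ R) :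
    ∫ z in Metric.ball (0 : EuclideanSpace ℝ (Fin n)) R,
        (1 - ‖z‖ ^ 2) / (1 + ‖z‖ ^ 2) ^ (n + 1) =
      volume.real (Metric.ball (0 : EuclideanSpace ℝ (Fin n)) 1) *
        (R ^ n / (1 + R ^ 2) ^ n) := by
  have : NeZero n := ⟨hn⟩
  have hn' : (n : ℝ) ≠ 0 := by exact_mod_cast hn
  let f : ℝ → ℝ := (Set.Iio R).indicator fun r => (1 - r ^ 2) / (1 + r ^ 2) ^ (n + 1)
  have hf : ∀ z : EuclideanSpace ℝ (Fin n),
      (Metric.ball (0 : EuclideanSpace ℝ (Fin n)) R).indicator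
        (fun z => (1 - ‖z‖ ^ 2) / (1 + ‖z‖ ^ 2) ^ (n + 1)) z = f ‖z‖ := by
    intro z
    by_cases hz : ‖z‖ < R
    · rw [Set.indicator_of_mem (mem_ball_zero_iff.2 hz)]
      simp [f, hz]
    · rw [Set.indicator_of_notMem (mt mem_ball_zero_iff.1 hz)]
      simp [f, hz]
  have hradial : ∫ r in Set.Ioi (0 : ℝ), r ^ (n - 1) • f r =
      R ^ n / (n * (1 + R ^ 2) ^ n) := by
    have hind : (fun r : ℝ => r ^ (n - 1) • f r) = (Set.Iio R).indicator
        fun r => r ^ (n - 1) * ((1 - r ^ 2) / (1 + r ^ 2) ^ (n + 1)) := by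
      ext r
      by_cases hr : r < R <;> simp [f, hr]
    rw [hind, setIntegral_indicator measurableSet_Iio, Set.Ioi_inter_Iio,
      ← integral_Ioc_eq_integral_Ioo, ← intervalIntegral.integral_of_le hR,
      intervalIntegral.integral_eq_sub_of_hasDerivAt
        (fun r _ => hasDerivAt_pow_div_one_add_sq_pow n hn r)]
    · simp [hn]
    · refine Continuous.intervalIntegrable ?_ _ _
      refine (continuous_pow _).mul (Continuous.div (by fun_prop) (by fun_prop) fun r => ?_)
      positivity
  rw [← integral_indicator measurableSet_ball, funext hf,
    integral_fun_norm_addHaar volume f, finrank_euclideanSpace_fin, hradial]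
  simp only [nsmul_eq_mul, smul_eq_mul]
  field_simp

theorem stmt6 (n : ℕ) (hn : 5 ≤ n) :
    ∃ C > 0, ∀ R : ℝ, 1 ≤ R →
      |∫ z in Metric.ball (0 : EuclideanSpace ℝ (Fin n)) R,
          (1 - ‖z‖ ^ 2) / (1 + ‖z‖ ^ 2) ^ (n + 1)| ≤ C * R ^ (-(n : ℝ)) := by
  refine ⟨volume.real (Metric.ball (0 : EuclideanSpace ℝ (Fin n)) 1), ?_, fun R hR => ?_⟩
  · exact ENNReal.toReal_pos (Metric.measure_ball_pos _ _ one_pos).ne' measure_ball_lt_top.ne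
  · have hR0 : 0 < R := by linarith
    rw [setIntegral_ball_one_sub_norm_sq n (by lia) R hR0.le, abs_of_nonneg (by positivity),
      Real.rpow_neg hR0.le, Real.rpow_natCast, ← div_pow, ← inv_pow]
    gcongr
    rw [inv_eq_one_div, div_le_div_iff₀ (by positivity) hR0]
    nlinarith
end

section
/- Let n ≥ 5 be an integer and k ∈ {1,…,n}. There exists a constant C > 0 such that for every R ≥ 2, |∫_{B(0,R)} |z_k|ⁿ·(1−‖z‖²)/(1+‖z‖²)^{n+1} dz| ≤ C·log R. -/
open MeasureTheory

/-- The radial integral of `r ^ (n - 1) / (1 + r ^ n)` is a logarithm. -/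
lemma integral_pow_div_one_add_pow {n : ℕ} (hn : n ≠ 0) {R : ℝ} (hR : 0 ≤ R) :
    ∫ r in (0 : ℝ)..R, r ^ (n - 1) * (n * (1 + r ^ n)⁻¹) = Real.log (1 + R ^ n) := by
  have hpos : ∀ r ∈ Set.uIcc 0 R, 0 < 1 + r ^ n := fun r hr => by
    rw [Set.uIcc_of_le hR] at hr
    have := pow_nonneg hr.1 n
    linarith
  rw [intervalIntegral.integral_eq_sub_of_hasDerivAt (f := fun r => Real.log (1 + r ^ n))]
  · simp [hn]
  · intro r hr
    refine (((hasDerivAt_pow n r).const_add 1).log (hpos r hr).ne').congr_deriv ?_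
    rw [div_eq_mul_inv]
    ring
  · refine ContinuousOn.intervalIntegrable ?_
    have : ∀ r ∈ Set.uIcc 0 R, 1 + r ^ n ≠ 0 := fun r hr => (hpos r hr).ne'
    fun_prop (disch := assumption)

lemma setIntegral_ball_inv_one_add_norm_pow {n : ℕ} (hn : n ≠ 0) {R : ℝ} (hR : 0 ≤ R) :
    ∫ z in Metric.ball (0 : EuclideanSpace ℝ (Fin n)) R, (n * (1 + ‖z‖ ^ n)⁻¹ : ℝ) =
      n * (volume.real (Metric.ball (0 : EuclideanSpace ℝ (Fin n)) 1) * Real.log (1 + R ^ n)) := by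
  have : Nonempty (Fin n) := Fin.pos_iff_nonempty.mp (Nat.pos_of_ne_zero hn)
  have hind : (Metric.ball (0 : EuclideanSpace ℝ (Fin n)) R).indicator
      (fun z => (n * (1 + ‖z‖ ^ n)⁻¹ : ℝ)) =
      fun z => (Set.Iio R).indicator (fun r : ℝ => (n * (1 + r ^ n)⁻¹ : ℝ)) ‖z‖ := by
    ext z
    by_cases hz : ‖z‖ < R <;> simp [hz]
  have hmul : (fun r : ℝ => r ^ (n - 1) • (Set.Iio R).indicator
      (fun r : ℝ => (n * (1 + r ^ n)⁻¹ : ℝ)) r) =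
      (Set.Iio R).indicator (fun r : ℝ => r ^ (n - 1) * (n * (1 + r ^ n)⁻¹)) := by
    ext r
    simp [Set.indicator_apply]
  rw [← integral_indicator measurableSet_ball, hind, integral_fun_norm_addHaar,
    finrank_euclideanSpace_fin, hmul, setIntegral_indicator measurableSet_Iio,
    Set.Ioi_inter_Iio, ← integral_Ioc_eq_integral_Ioo, ← intervalIntegral.integral_of_le hR,
    integral_pow_div_one_add_pow hn hR]
  simp

lemma pow_mul_abs_div_le {n : ℕ} {x r : ℝ} (hx : |x| ≤ r) :
    |x| ^ n * (|1 - r ^ 2| / (1 + r ^ 2) ^ (n + 1)) ≤ 2 * (1 + r ^ n)⁻¹ := by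
  have hr : 0 ≤ r := (abs_nonneg x).trans hx
  have hq : 0 < 1 + r ^ 2 := by positivity
  have h1 : |1 - r ^ 2| ≤ 1 + r ^ 2 := abs_le.mpr ⟨by nlinarith, by nlinarith⟩
  have h2 : |x| ^ n ≤ r ^ n := pow_le_pow_left₀ (abs_nonneg x) hx n
  have h3 : r ^ n ≤ (1 + r ^ 2) ^ n := pow_le_pow_left₀ hr (by nlinarith [sq_nonneg (r - 1)]) n
  have h4 : r ^ n * r ^ n ≤ (1 + r ^ 2) ^ n := by
    rw [← mul_pow]
    exact pow_le_pow_left₀ (by positivity) (by nlinarith) n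
  calc |x| ^ n * (|1 - r ^ 2| / (1 + r ^ 2) ^ (n + 1))
      ≤ r ^ n * ((1 + r ^ 2) / (1 + r ^ 2) ^ (n + 1)) := by gcongr
    _ = r ^ n / (1 + r ^ 2) ^ n := by field_simp; ring
    _ ≤ 2 * (1 + r ^ n)⁻¹ := by
      rw [← div_eq_mul_inv, div_le_div_iff₀ (by positivity) (by positivity)]
      linarith

theorem stmt10 (n : ℕ) (hn : 5 ≤ n) (k : Fin n) :
    ∃ C > 0, ∀ R : ℝ, 2 ≤ R →
      |∫ z in Metric.ball (0 : EuclideanSpace ℝ (Fin n)) R,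
          |z k| ^ n * ((1 - ‖z‖ ^ 2) / (1 + ‖z‖ ^ 2) ^ (n + 1))| ≤ C * Real.log R := by
  set ω := volume.real (Metric.ball (0 : EuclideanSpace ℝ (Fin n)) 1)
  have hω : 0 ≤ ω := measureReal_nonneg
  have hn0 : n ≠ 0 := by omega
  have hn1 : (1 : ℝ) ≤ n := by exact_mod_cast Nat.one_le_iff_ne_zero.mpr hn0
  refine ⟨2 * (n * (ω * (n + 1))) + 1, by positivity, fun R hR => ?_⟩
  have hlogR : 0 ≤ Real.log R := Real.log_nonneg (by linarith)
  have hlog : Real.log (1 + R ^ n) ≤ (n + 1) * Real.log R := by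
    have : 1 ≤ R ^ n := one_le_pow₀ (by linarith)
    rw [← Nat.cast_add_one, ← Real.log_pow]
    exact Real.log_le_log (by positivity) (by rw [pow_succ]; nlinarith)
  have hint : IntegrableOn (fun z : EuclideanSpace ℝ (Fin n) => 2 * (n * (1 + ‖z‖ ^ n)⁻¹ : ℝ))
      (Metric.ball 0 R) := by
    have hcont : Continuous fun z : EuclideanSpace ℝ (Fin n) =>
        2 * (n * (1 + ‖z‖ ^ n)⁻¹ : ℝ) := by
      have : ∀ z : EuclideanSpace ℝ (Fin n), 1 + ‖z‖ ^ n ≠ 0 := fun z => by positivity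
      fun_prop (disch := assumption)
    exact (hcont.continuousOn.integrableOn_compact (isCompact_closedBall 0 R)).mono_set
      Metric.ball_subset_closedBall
  rw [← Real.norm_eq_abs]
  calc _ ≤ ∫ z in Metric.ball (0 : EuclideanSpace ℝ (Fin n)) R,
          2 * (n * (1 + ‖z‖ ^ n)⁻¹ : ℝ) := by
        refine norm_integral_le_of_norm_le hint (ae_of_all _ fun z => ?_)
        have hz : |z k| ≤ ‖z‖ := by simpa using PiLp.norm_apply_le z k
        have hb := pow_mul_abs_div_le (n := n) hz
        have hinv : 0 ≤ (1 + ‖z‖ ^ n)⁻¹ := by positivity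
        rw [norm_mul, norm_div, Real.norm_eq_abs, Real.norm_eq_abs, Real.norm_eq_abs,
          abs_of_nonneg (by positivity : 0 ≤ |z k| ^ n),
          abs_of_pos (by positivity : 0 < (1 + ‖z‖ ^ 2) ^ (n + 1))]
        nlinarith
    _ = 2 * (n * (ω * Real.log (1 + R ^ n))) := by
        rw [integral_const_mul, setIntegral_ball_inv_one_add_norm_pow hn0 (by linarith)]
    _ ≤ 2 * (n * (ω * ((n + 1) * Real.log R))) := by gcongr
    _ ≤ (2 * (n * (ω * (n + 1))) + 1) * Real.log R := by nlinarith
end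

section
/- Let n ≥ 5 be an integer, let w₂ > w₁ > 0 be real weights, and let d ≥ 0. Define ε(s,t) = (s/t + t/s + s·t·d²)^{−(n−4)/2} for s, t > 0. There exists a constant c > 0, depending only on n, w₁ and w₂, such that for all s, t > 0 with t ≥ 2s one has w₁·s·(∂ε/∂s)(s,t) + w₂·t·(∂ε/∂t)(s,t) ≤ −c·ε(s,t). -/
/-- Derivative in the first concentration of a power of the bubble interaction quantity. -/
theorem hasDerivAt_interaction_left (p d s t : ℝ) (hs : 0 < s) (ht : 0 < t) :
    HasDerivAt (fun x => (x / t + t / x + x * t * d ^ 2) ^ p)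
      ((1 / t - t / s ^ 2 + t * d ^ 2) * p * (s / t + t / s + s * t * d ^ 2) ^ (p - 1)) s := by
  have hQ : 0 < s / t + t / s + s * t * d ^ 2 := by positivity
  have h₁ : HasDerivAt (fun x : ℝ => x / t) (1 / t) s := (hasDerivAt_id s).div_const t
  have h₂ : HasDerivAt (fun x : ℝ => t / x) (-(t / s ^ 2)) s := by
    simpa [div_eq_mul_inv] using (hasDerivAt_inv hs.ne').const_mul t
  have h₃ : HasDerivAt (fun x : ℝ => x * t * d ^ 2) (t * d ^ 2) s := by
    simpa using ((hasDerivAt_id s).mul_const t).mul_const (d ^ 2)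
  have h := ((h₁.add h₂).add h₃).rpow_const (p := p) (Or.inl hQ.ne')
  rw [sub_eq_add_neg (1 / t)]
  exact h

/-- Derivative in the second concentration of a power of the bubble interaction quantity. -/
theorem hasDerivAt_interaction_right (p d s t : ℝ) (hs : 0 < s) (ht : 0 < t) :
    HasDerivAt (fun x => (s / x + x / s + s * x * d ^ 2) ^ p)
      ((1 / s - s / t ^ 2 + s * d ^ 2) * p * (s / t + t / s + s * t * d ^ 2) ^ (p - 1)) t := by
  have h := hasDerivAt_interaction_left p d t s ht hs
  simpa only [add_comm (_ / s) (s / _), mul_comm _ s] using h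

theorem stmt18 (n : ℕ) (hn : 5 ≤ n) (w1 w2 : ℝ) (hw1 : 0 < w1) (hw12 : w1 < w2) :
    ∃ c > 0, ∀ d : ℝ, 0 ≤ d → ∀ s t : ℝ, 0 < s → 0 < t → 2 * s ≤ t →
      w1 * s * deriv (fun s' => (s' / t + t / s' + s' * t * d ^ 2) ^ (-(((n : ℝ) - 4) / 2))) s +
          w2 * t * deriv (fun t' => (s / t' + t' / s + s * t' * d ^ 2) ^ (-(((n : ℝ) - 4) / 2))) t ≤
        -c * (s / t + t / s + s * t * d ^ 2) ^ (-(((n : ℝ) - 4) / 2)) := by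
  have hn' : (5 : ℝ) ≤ n := by exact_mod_cast hn
  obtain ⟨a, ha⟩ : ∃ a : ℝ, a = ((n : ℝ) - 4) / 2 := ⟨_, rfl⟩
  have ha0 : 0 < a := by rw [ha]; linarith
  rw [← ha]
  refine ⟨a * (3 / 5 * (w2 - w1)), mul_pos ha0 (by linarith), ?_⟩
  intro d _ s t hs ht hst
  rw [(hasDerivAt_interaction_left (-a) d s t hs ht).deriv,
    (hasDerivAt_interaction_right (-a) d s t hs ht).deriv]
  have hQ : 0 < s / t + t / s + s * t * d ^ 2 := by positivity
  have hpow : (s / t + t / s + s * t * d ^ 2) ^ (-a) =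
      (s / t + t / s + s * t * d ^ 2) ^ (-a - 1) * (s / t + t / s + s * t * d ^ 2) := by
    rw [← Real.rpow_add_one hQ.ne', sub_add_cancel]
  have hP : 0 < (s / t + t / s + s * t * d ^ 2) ^ (-a - 1) := Real.rpow_pos_of_pos hQ _
  rw [hpow]
  generalize (s / t + t / s + s * t * d ^ 2) ^ (-a - 1) = P at hP
  have hratio : 4 * (s / t) ≤ t / s := by
    rw [← mul_div_assoc, div_le_div_iff₀ ht hs]
    nlinarith
  have hD : 0 ≤ s * t * d ^ 2 := by positivity
  have hs' : s * (1 / t - t / s ^ 2 + t * d ^ 2) = s / t - t / s + s * t * d ^ 2 := by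
    field_simp
  have ht' : t * (1 / s - s / t ^ 2 + s * d ^ 2) = t / s - s / t + s * t * d ^ 2 := by
    field_simp
  have key : 3 / 5 * (w2 - w1) * (s / t + t / s + s * t * d ^ 2) ≤
      w1 * (s / t - t / s + s * t * d ^ 2) + w2 * (t / s - s / t + s * t * d ^ 2) := by
    have h₁ := mul_nonneg (sub_nonneg.2 hw12.le) (sub_nonneg.2 hratio)
    have h₂ : 0 ≤ (2 / 5 * w2 + 8 / 5 * w1) * (s * t * d ^ 2) :=
      mul_nonneg (by linarith) hD
    linarith
  rw [← hs', ← ht'] at key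
  have := mul_le_mul_of_nonneg_left key (mul_pos ha0 hP).le
  linarith
end
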